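/- Let f_0, f_1, …, f_n ∈ L1 and let α_0 > 0. Suppose there exists g ∈ B(L∞) with ∫ f_i g dμ = 0 for each 1 ≤ i ≤ n and ∫ f_0 g dμ ≥ α_0. Then there exists u ∈ L∞ with |u(t)| = 1 for almost every t, ∫ f_i u dμ = 0 for each 1 ≤ i ≤ n, and ∫ f_0 u dμ = α_0. -/

import Mathlib

open MeasureTheory Filter Topology

/-- Lebesgue measure on `[0,1]`. -/
noncomputable def mu : Measure ℝ := volume.restrict (Set.Icc 0 1)

section LinftyDuality

variable {α : Type*} {m : MeasurableSpace α} {μ : Measure α}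

theorem Lp_top_norm_le_one_iff [IsFiniteMeasure μ] (g : Lp ℝ ⊤ μ) :
    ‖g‖ ≤ 1 ↔ ∀ᵐ t ∂μ, |g t| ≤ 1 := by
  constructor
  · intro h
    have hle : eLpNormEssSup g μ ≤ ENNReal.ofReal 1 := by
      rw [← eLpNorm_exponent_top]
      refine (ENNReal.le_ofReal_iff_toReal_le (Lp.eLpNorm_ne_top g) zero_le_one).2 ?_
      rwa [Lp.norm_def] at h
    filter_upwards [ae_le_eLpNormEssSup (f := g) (μ := μ)] with t ht
    have := ht.trans hle
    rwa [← ofReal_norm, ENNReal.ofReal_le_ofReal_iff zero_le_one, Real.norm_eq_abs] at this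
  · intro h
    simpa using Lp.norm_le_of_ae_bound (f := g) zero_le_one h

/-- The canonical map from `L∞` to the dual of `L1`, sending `g` to `f ↦ ∫ g f dμ`. -/
noncomputable def LinftyToDual (μ : Measure α) : Lp ℝ ⊤ μ →L[ℝ] StrongDual ℝ (Lp ℝ 1 μ) :=
  (ContinuousLinearMap.mul ℝ ℝ).lpPairing μ ⊤ 1

theorem LinftyToDual_apply (g : Lp ℝ ⊤ μ) (f : Lp ℝ 1 μ) :
    LinftyToDual μ g f = ∫ t, f t * g t ∂μ := by
  simp [LinftyToDual, ContinuousLinearMap.lpPairing_eq_integral, mul_comm]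

theorem norm_LinftyToDual_le (g : Lp ℝ ⊤ μ) : ‖LinftyToDual μ g‖ ≤ ‖g‖ := by
  refine ContinuousLinearMap.opNorm_le_bound _ (norm_nonneg _) fun f => ?_
  calc ‖LinftyToDual μ g f‖ ≤ ‖(ContinuousLinearMap.mul ℝ ℝ).holder 1 g f‖ := by
        rw [LinftyToDual, ContinuousLinearMap.lpPairing_eq_integral,
          ← integral_congr_ae ((ContinuousLinearMap.mul ℝ ℝ).coeFn_holder (r := 1) g f),
          ← L1.integral_eq_integral]
        exact L1.norm_integral_le _
    _ ≤ ‖ContinuousLinearMap.mul ℝ ℝ‖ * ‖g‖ * ‖f‖ :=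
        ContinuousLinearMap.norm_holder_apply_apply_le _ _ _
    _ ≤ ‖g‖ * ‖f‖ := by
        have := ContinuousLinearMap.opNorm_mul_le ℝ ℝ
        gcongr
        nlinarith [norm_nonneg g]

theorem LinftyToDual_indicatorConstLp (g : Lp ℝ ⊤ μ) {s : Set α} (hs : MeasurableSet s)
    (hμs : μ s ≠ ⊤) (c : ℝ) :
    LinftyToDual μ g (indicatorConstLp 1 hs hμs c) = c * ∫ t in s, g t ∂μ := by
  rw [LinftyToDual_apply, ← integral_indicator hs, ← integral_const_mul]
  refine integral_congr_ae ?_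
  filter_upwards [indicatorConstLp_coeFn (p := 1) (hs := hs) (hμs := hμs) (c := c)] with t ht
  rw [ht]
  by_cases h : t ∈ s <;> simp [h]

theorem LinftyToDual_injective [IsFiniteMeasure μ] : Function.Injective (LinftyToDual μ) := by
  refine (injective_iff_map_eq_zero _).2 fun g hg => ?_
  have hint : Integrable g μ := (Lp.memLp g).integrable le_top
  refine Lp.eq_zero_iff_ae_eq_zero.2
    (hint.ae_eq_zero_of_forall_setIntegral_eq_zero fun s hs hμs => ?_)
  simpa [hg] using (LinftyToDual_indicatorConstLp g hs hμs.ne 1).symm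

/-- Every functional in the dual unit ball of `L1` comes from the unit ball of `L∞`. -/
theorem exists_LinftyToDual_eq [IsFiniteMeasure μ] (φ : StrongDual ℝ (Lp ℝ 1 μ)) (hφ : ‖φ‖ ≤ 1) :
    ∃ g : Lp ℝ ⊤ μ, ‖g‖ ≤ 1 ∧ LinftyToDual μ g = φ := by
  let ι : Lp ℝ 2 μ →L[ℝ] Lp ℝ 1 μ :=
    (ContinuousLinearMap.mul ℝ ℝ).holderL μ 2 2 1 (Lp.const 2 μ 1)
  let h : Lp ℝ 2 μ := (InnerProductSpace.toDual ℝ (Lp ℝ 2 μ)).symm (φ ∘L ι)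
  have hint : Integrable h μ := (Lp.memLp h).integrable one_le_two
  have hι (s : Set α) (hs : MeasurableSet s) :
      ι (indicatorConstLp 2 hs (measure_ne_top μ s) 1) =
        indicatorConstLp 1 hs (measure_ne_top μ s) 1 := by
    refine Lp.ext ?_
    refine ((ContinuousLinearMap.mul ℝ ℝ).coeFn_holder (r := 1) (Lp.const 2 μ (1 : ℝ)) _).trans ?_
    filter_upwards [Lp.coeFn_const (p := 2) (μ := μ) (1 : ℝ),
      indicatorConstLp_coeFn (p := 1) (hs := hs) (hμs := measure_ne_top μ s) (c := (1 : ℝ)),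
      indicatorConstLp_coeFn (p := 2) (hs := hs) (hμs := measure_ne_top μ s) (c := (1 : ℝ))]
      with t h1 h2 h3
    rw [h1, h2, h3, Function.const_apply, ContinuousLinearMap.mul_apply', one_mul]
  have hset (s : Set α) (hs : MeasurableSet s) :
      φ (indicatorConstLp 1 hs (measure_ne_top μ s) 1) = ∫ t in s, h t ∂μ := by
    rw [← L2.inner_indicatorConstLp_one (𝕜 := ℝ) hs (measure_ne_top μ s) h, real_inner_comm,
      InnerProductSpace.toDual_symm_apply, ContinuousLinearMap.comp_apply, hι]
  have hbound (s : Set α) (hs : MeasurableSet s) : |∫ t in s, h t ∂μ| ≤ μ.real s := by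
    rw [← hset s hs, ← Real.norm_eq_abs]
    refine (φ.le_of_opNorm_le hφ _).trans ?_
    simp [norm_indicatorConstLp]
  have hle : ∀ᵐ t ∂μ, h t ≤ 1 := by
    refine ae_le_of_forall_setIntegral_le hint (integrable_const 1) fun s hs _ => ?_
    simpa using (abs_le.1 (hbound s hs)).2
  have hge : ∀ᵐ t ∂μ, -1 ≤ h t := by
    refine ae_le_of_forall_setIntegral_le (integrable_const (-1)) hint fun s hs _ => ?_
    simpa using (abs_le.1 (hbound s hs)).1
  have habs : ∀ᵐ t ∂μ, |h t| ≤ 1 := by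
    filter_upwards [hle, hge] with t h1 h2 using abs_le.2 ⟨h2, h1⟩
  have hmem : MemLp h ⊤ μ := memLp_top_of_bound (Lp.aestronglyMeasurable h) 1 habs
  have hcoe : hmem.toLp h =ᵐ[μ] h := hmem.coeFn_toLp
  refine ⟨hmem.toLp h, (Lp_top_norm_le_one_iff _).2 ?_, ?_⟩
  · filter_upwards [hcoe, habs] with t h1 h2
    rwa [h1]
  · ext f
    refine Lp.induction ENNReal.one_ne_top
      (fun f => LinftyToDual μ (hmem.toLp h) f = φ f) ?_ ?_ ?_ f
    · intro c s hs hμs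
      rw [Lp.simpleFunc.coe_indicatorConst, LinftyToDual_indicatorConstLp,
        setIntegral_congr_ae hs (hcoe.mono fun t ht _ => ht), ← hset s hs, ← smul_eq_mul, ← map_smul]
      congr 1
      refine Lp.ext ?_
      filter_upwards [Lp.coeFn_smul c (indicatorConstLp 1 hs (measure_ne_top μ s) (1 : ℝ)),
        indicatorConstLp_coeFn (p := 1) (hs := hs) (hμs := measure_ne_top μ s) (c := (1 : ℝ)),
        indicatorConstLp_coeFn (p := 1) (hs := hs) (hμs := measure_ne_top μ s) (c := c)]
        with t h1 h2 h3
      rw [h1, h3, Pi.smul_apply, h2]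
      by_cases h : t ∈ s <;> simp [h]
    · intro f g hf hg _ h1 h2
      rw [map_add, map_add, h1, h2]
    · exact isClosed_eq (ContinuousLinearMap.continuous _) φ.continuous

end LinftyDuality

instance : IsFiniteMeasure mu := by
  unfold mu
  infer_instance

instance : NullSingletonClass mu := by
  unfold mu
  infer_instance

/-- A point of the unit ball of `L∞[0,1]` which is not unimodular is the midpoint of a
nondegenerate segment in the ball in a direction annihilated by finitely many given functions. -/
theorem exists_ne_zero_forall_norm_add_le_one {ι : Type*} [Finite ι] (f : ι → Lp ℝ 1 mu)
    (g : Lp ℝ ⊤ mu) (hg : ‖g‖ ≤ 1) (hne : ¬ ∀ᵐ t ∂mu, |g t| = 1) :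
    ∃ k : Lp ℝ ⊤ mu, k ≠ 0 ∧ ‖g + k‖ ≤ 1 ∧ ‖g - k‖ ≤ 1 ∧ ∀ i, LinftyToDual mu k (f i) = 0 := by
  have hg' := (Lp_top_norm_le_one_iff g).1 hg
  obtain ⟨ε, hε, hA⟩ : ∃ ε : ℝ, 0 < ε ∧ mu {t | |g t| ≤ 1 - ε} ≠ 0 := by
    by_contra! hcon
    refine hne ?_
    have hall : ∀ᵐ t ∂mu, ∀ n : ℕ, ¬ |g t| ≤ 1 - 1 / ((n : ℝ) + 1) :=
      ae_all_iff.2 fun n => by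
        rw [ae_iff]
        simpa using hcon (1 / ((n : ℝ) + 1)) (by positivity)
    filter_upwards [hall, hg'] with t h1 h2
    refine le_antisymm h2 (le_of_not_gt fun hlt => ?_)
    obtain ⟨n, hn⟩ := exists_nat_one_div_lt (sub_pos.2 hlt)
    exact h1 n (by linarith)
  set A : Set ℝ := {t | |g t| ≤ 1 - ε}
  have hAm : MeasurableSet A :=
    measurableSet_le (Lp.stronglyMeasurable g).measurable.abs measurable_const
  have hbdd (p : Polynomial ℝ) : ∃ M, 0 < M ∧ ∀ᵐ t ∂mu, |p.eval t| ≤ M := by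
    obtain ⟨M, hM⟩ := isCompact_Icc.exists_bound_of_continuousOn (s := Set.Icc (0 : ℝ) 1)
      p.continuous.continuousOn
    refine ⟨max M 1, by positivity, ?_⟩
    exact (ae_restrict_mem measurableSet_Icc).mono fun t ht => (hM t ht).trans (le_max_left _ _)
  have hint (p : Polynomial ℝ) (i : ι) : Integrable (fun t => p.eval t * f i t) (mu.restrict A) := by
    obtain ⟨M, -, hM⟩ := hbdd p
    exact ((L1.integrable_coeFn (f i)).bdd_mul p.continuous.aestronglyMeasurable hM).restrict
  let T : Polynomial ℝ →ₗ[ℝ] (ι → ℝ) :=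
    { toFun := fun p i => ∫ t in A, p.eval t * f i t ∂mu
      map_add' := fun p q => by
        ext i
        simp only [Polynomial.eval_add, add_mul, Pi.add_apply]
        exact integral_add (hint p i) (hint q i)
      map_smul' := fun c p => by
        ext i
        simp only [Polynomial.eval_smul, smul_eq_mul, mul_assoc, RingHom.id_apply, Pi.smul_apply]
        exact integral_const_mul _ _ }
  obtain ⟨p, hTp, hp⟩ : ∃ p, T p = 0 ∧ p ≠ 0 := by
    by_contra! hcon
    exact Polynomial.not_finite
      (FiniteDimensional.of_injective T ((injective_iff_map_eq_zero T).2 hcon))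
  obtain ⟨M, hM0, hM⟩ := hbdd p
  let k₀ : ℝ → ℝ := A.indicator fun t => ε / M * p.eval t
  have hk₀ : ∀ᵐ t ∂mu, |k₀ t| ≤ A.indicator (fun _ => ε) t := by
    filter_upwards [hM] with t ht
    by_cases h : t ∈ A
    · simp only [k₀, Set.indicator_of_mem h, abs_mul, abs_of_pos (div_pos hε hM0)]
      calc ε / M * |p.eval t| ≤ ε / M * M := by gcongr
        _ = ε := by field_simp
    · simp [k₀, h]
  have hmeas : AEStronglyMeasurable k₀ mu :=
    ((p.continuous.measurable.const_mul _).indicator hAm).aestronglyMeasurable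
  have hmem : MemLp k₀ ⊤ mu := by
    refine memLp_top_of_bound hmeas ε (hk₀.mono fun t ht => ht.trans ?_)
    exact Set.indicator_le_self' (fun _ _ => hε.le) t
  have hcoe : hmem.toLp k₀ =ᵐ[mu] k₀ := hmem.coeFn_toLp
  have hsum : ∀ᵐ t ∂mu, |g t| + |k₀ t| ≤ 1 := by
    filter_upwards [hk₀, hg'] with t h1 h2
    by_cases h : t ∈ A
    · rw [Set.indicator_of_mem h] at h1
      have h3 : |g t| ≤ 1 - ε := h
      linarith
    · rw [Set.indicator_of_notMem h] at h1
      linarith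
  refine ⟨hmem.toLp k₀, fun hzero => hA ?_, ?_, ?_, fun i => ?_⟩
  · have hz : ∀ᵐ t ∂mu, k₀ t = 0 := by
      filter_upwards [hcoe, Lp.eq_zero_iff_ae_eq_zero.1 hzero] with t h1 h2
      rw [← h1, h2, Pi.zero_apply]
    have hroot : ∀ᵐ t ∂mu, t ∉ (p.roots.toFinset : Set ℝ) :=
      compl_mem_ae_iff.2 (Finset.measure_zero _ _)
    have : ∀ᵐ t ∂mu, t ∉ A := by
      filter_upwards [hz, hroot] with t h1 h2 h3
      refine h2 ?_
      simp only [k₀, Set.indicator_of_mem h3, mul_eq_zero, div_eq_zero_iff, hε.ne', hM0.ne',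
        or_self, false_or] at h1
      simpa [hp] using h1
    simpa [ae_iff] using this
  · refine (Lp_top_norm_le_one_iff _).2 ?_
    filter_upwards [hcoe, hsum, Lp.coeFn_add g (hmem.toLp k₀)] with t h1 h2 h3
    rw [h3, Pi.add_apply, h1]
    exact (abs_add_le _ _).trans h2
  · refine (Lp_top_norm_le_one_iff _).2 ?_
    filter_upwards [hcoe, hsum, Lp.coeFn_sub g (hmem.toLp k₀)] with t h1 h2 h3
    rw [h3, Pi.sub_apply, h1]
    exact (abs_sub _ _).trans h2
  · have hTi : ∫ t in A, p.eval t * f i t ∂mu = 0 := congrFun hTp i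
    rw [LinftyToDual_apply]
    calc ∫ t, f i t * hmem.toLp k₀ t ∂mu
        = ∫ t, A.indicator (fun t => ε / M * (p.eval t * f i t)) t ∂mu := by
          refine integral_congr_ae ?_
          filter_upwards [hcoe] with t ht
          rw [ht]
          by_cases h : t ∈ A
          · simp only [k₀, Set.indicator_of_mem h]
            ring
          · simp [k₀, h]
      _ = 0 := by rw [integral_indicator hAm, integral_const_mul, hTi, mul_zero]

instance {E : Type*} [AddCommGroup E] [Module ℝ E] [TopologicalSpace E] :
    LocallyConvexSpace ℝ (WeakDual ℝ E) :=
  WeakBilin.locallyConvexSpace (B := topDualPairing ℝ E)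

/-- If finitely many moment conditions can be met in the unit ball of `L∞[0,1]`, they can be met by
a unimodular function. -/
theorem exists_unimodular_forall_LinftyToDual_eq {ι : Type*} [Finite ι] (f : ι → Lp ℝ 1 mu)
    (b : ι → ℝ) (g : Lp ℝ ⊤ mu) (hg : ‖g‖ ≤ 1) (hgb : ∀ i, LinftyToDual mu g (f i) = b i) :
    ∃ u : Lp ℝ ⊤ mu, (∀ᵐ t ∂mu, |u t| = 1) ∧ ∀ i, LinftyToDual mu u (f i) = b i := by
  let K : Set (WeakDual ℝ (Lp ℝ 1 mu)) :=
    WeakDual.toStrongDual ⁻¹' Metric.closedBall 0 1 ∩ ⋂ i, {φ | φ (f i) = b i}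
  have hmemK (h : Lp ℝ ⊤ mu) (hh : ‖h‖ ≤ 1) (hb : ∀ i, LinftyToDual mu h (f i) = b i) :
      StrongDual.toWeakDual (LinftyToDual mu h) ∈ K := by
    refine ⟨?_, Set.mem_iInter.2 hb⟩
    simpa using (norm_LinftyToDual_le h).trans hh
  have hK : IsCompact K := (WeakDual.isCompact_closedBall 0 1).inter_right
    (isClosed_iInter fun i => isClosed_eq (WeakDual.eval_continuous _) continuous_const)
  obtain ⟨φ, hφ⟩ := hK.extremePoints_nonempty ⟨_, hmemK g hg hgb⟩
  obtain ⟨⟨hφ1, hφb⟩, hext⟩ := mem_extremePoints.1 hφ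
  obtain ⟨u, hu, hφu⟩ := exists_LinftyToDual_eq (WeakDual.toStrongDual φ) (by simpa using hφ1)
  have hub (i : ι) : LinftyToDual mu u (f i) = b i := by
    rw [hφu]
    exact Set.mem_iInter.1 hφb i
  refine ⟨u, ?_, hub⟩
  by_contra hne
  obtain ⟨k, hk0, hadd, hsub, hk⟩ := exists_ne_zero_forall_norm_add_le_one f u hu hne
  have hφu' : StrongDual.toWeakDual (LinftyToDual mu u) = φ := by rw [hφu]; rfl
  have hmid := hext _ (hmemK (u + k) hadd fun i => by simp [hub, hk])
    _ (hmemK (u - k) hsub fun i => by simp [hub, hk])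
    ⟨1 / 2, 1 / 2, by norm_num, by norm_num, by norm_num, by
      rw [← hφu', map_add, map_sub, map_add, map_sub]
      module⟩
  have hzero : LinftyToDual mu k = 0 := by
    have h1 := hmid.1
    rw [← hφu', map_add, map_add, add_eq_left] at h1
    exact StrongDual.toWeakDual.map_eq_zero_iff.1 h1
  exact hk0 (LinftyToDual_injective (hzero.trans (map_zero _).symm))

/-- Lemma 3′: let `f₀, f₁, …, f_n ∈ L₁` and `α₀ > 0`.  If there is `g` in the unit ball of
`L∞` with `∫ fᵢ g dμ = 0` for `1 ≤ i ≤ n` and `∫ f₀ g dμ ≥ α₀`, then there is a `±1`-valued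
function `u ∈ L∞` with `∫ fᵢ u dμ = 0` for `1 ≤ i ≤ n` and `∫ f₀ u dμ = α₀`. -/
theorem extreme_point_lemma (n : ℕ) (f : Fin (n + 1) → Lp ℝ 1 mu)
    (α₀ : ℝ) (hα₀ : 0 < α₀) (g : Lp ℝ ⊤ mu) (hg : ‖g‖ ≤ 1)
    (hgF : ∀ i : Fin (n + 1), i ≠ 0 → ∫ t, f i t * g t ∂mu = 0)
    (hg0 : α₀ ≤ ∫ t, f 0 t * g t ∂mu) :
    ∃ u : Lp ℝ ⊤ mu,
      (∀ᵐ t ∂mu, |u t| = 1) ∧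
      (∀ i : Fin (n + 1), i ≠ 0 → ∫ t, f i t * u t ∂mu = 0) ∧
      ∫ t, f 0 t * u t ∂mu = α₀ := by
  set c := ∫ t, f 0 t * g t ∂mu with hc
  have hcpos : 0 < c := hα₀.trans_le hg0
  obtain ⟨u, hu, hfu⟩ := exists_unimodular_forall_LinftyToDual_eq f
    (fun i => if i = 0 then α₀ else 0) ((α₀ / c) • g)
    (by
      rw [norm_smul, Real.norm_of_nonneg (by positivity)]
      exact mul_le_one₀ ((div_le_one hcpos).2 hg0) (norm_nonneg _) hg)
    (fun i => by
      rw [map_smul, smul_apply, LinftyToDual_apply, smul_eq_mul]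
      split_ifs with hi
      · rw [hi, ← hc, div_mul_cancel₀ _ hcpos.ne']
      · rw [hgF i hi, mul_zero])
  refine ⟨u, hu, fun i hi => ?_, ?_⟩
  · rw [← LinftyToDual_apply, hfu, if_neg hi]
  · rw [← LinftyToDual_apply, hfu, if_pos rfl]
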